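/- Let G be a finite group, G₀ ≤ G a subgroup, and 1 the one-dimensional trivial representation of G₀. Suppose that for every irreducible finite-dimensional complex representation τ of G₀ and every g ∈ G₀ one has χ_{Ind_{G₀}^G τ}(g) = χ_{Ind_{G₀}^G 1}(g) · χ_τ(g). Then (G, G₀) is an admissible pair. -/

import Mathlib

variable {G : Type} [Group G] (G₀ : Subgroup G)

/-- The carrier of the induced representation: `G₀`-equivariant functions `G → V`. -/
def indCarrier {V : Type*} [AddCommGroup V] [Module ℂ V]
    (τ : Representation ℂ G₀ V) : Submodule ℂ (G → V) where
  carrier := {f | ∀ (h : G₀) (x : G), f (↑h * x) = τ h (f x)}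
  add_mem' := by
    intro f g hf hg h x
    simp only [Pi.add_apply, hf h x, hg h x, map_add]
  zero_mem' := by
    intro h x
    simp
  smul_mem' := by
    intro c f hf h x
    simp only [Pi.smul_apply, hf h x, map_smul]

/-- The representation of `G` induced by a representation `τ` of the subgroup `G₀`. -/
def indRep {V : Type*} [AddCommGroup V] [Module ℂ V]
    (τ : Representation ℂ G₀ V) : Representation ℂ G (indCarrier G₀ τ) where
  toFun g :=
    { toFun := fun f => ⟨fun x => (f : G → V) (x * g), by
        intro h x
        simp only
        rw [mul_assoc]
        exact f.2 h (x * g)⟩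
      map_add' := by intro f₁ f₂; apply Subtype.ext; funext x; rfl
      map_smul' := by intro c f; apply Subtype.ext; funext x; rfl }
  map_one' := by
    apply LinearMap.ext
    intro f
    apply Subtype.ext
    funext x
    simp
  map_mul' := by
    intro g₁ g₂
    apply LinearMap.ext
    intro f
    apply Subtype.ext
    funext x
    simp [mul_assoc]

/-- The character of the induced representation. -/
noncomputable def indChar [Fintype G] {V : Type*} [AddCommGroup V] [Module ℂ V]
    [FiniteDimensional ℂ V] (τ : Representation ℂ G₀ V) (g : G) : ℂ :=
  LinearMap.trace ℂ (indCarrier G₀ τ) (indRep G₀ τ g)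

/-- The pair `(G, G₀)` is *admissible* if for every irreducible finite-dimensional complex
representation `τ` of `G₀`, every `g ∈ G₀` and every `s ∈ X(g) = {s : s g s⁻¹ ∈ G₀}`, the
character of `τ` satisfies `χ_τ(s g s⁻¹) = χ_τ(g)`. -/
def IsAdmissiblePair (G : Type) [Group G] (G₀ : Subgroup G) : Prop :=
  ∀ (τ : FDRep ℂ G₀), CategoryTheory.Simple τ →
    ∀ (g s : G) (hg : g ∈ G₀) (hs : s * g * s⁻¹ ∈ G₀),
      τ.character ⟨s * g * s⁻¹, hs⟩ = τ.character ⟨g, hg⟩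

/-- The trace of an endomorphism of `ι → V` is the sum of the traces of its diagonal blocks. -/
theorem trace_pi_eq_sum_trace_diag {ι V : Type*} [Fintype ι] [DecidableEq ι] [AddCommGroup V]
    [Module ℂ V] [FiniteDimensional ℂ V] (T : (ι → V) →ₗ[ℂ] (ι → V)) :
    LinearMap.trace ℂ (ι → V) T = ∑ i, LinearMap.trace ℂ V
      (LinearMap.proj i ∘ₗ T ∘ₗ LinearMap.single ℂ (fun _ => V) i) := by
  have hT : T = ∑ i, LinearMap.single ℂ (fun _ => V) i ∘ₗ (LinearMap.proj i ∘ₗ T) := by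
    ext1 i
    ext v j
    simp [Finset.sum_apply, Pi.single_apply]
  conv_lhs => rw [hT, map_sum]
  refine Finset.sum_congr rfl fun i _ => ?_
  rw [LinearMap.trace_comp_comm', LinearMap.comp_assoc]

/-- The averaging projection of `G → V` onto the carrier of the induced representation. -/
noncomputable def indProj [Fintype G₀] {V : Type*}
    [AddCommGroup V] [Module ℂ V] (τ : Representation ℂ G₀ V) : (G → V) →ₗ[ℂ] (G → V) where
  toFun f x := (Fintype.card G₀ : ℂ)⁻¹ • ∑ h : G₀, τ h⁻¹ (f (h * x))
  map_add' f₁ f₂ := by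
    funext x
    simp [Finset.sum_add_distrib]
  map_smul' c f := by
    funext x
    simp only [Pi.smul_apply, map_smul, RingHom.id_apply]
    rw [← Finset.smul_sum, smul_comm]

theorem indProj_mem [Fintype G₀] {V : Type*}
    [AddCommGroup V] [Module ℂ V] (τ : Representation ℂ G₀ V) (f : G → V) :
    indProj G₀ τ f ∈ indCarrier G₀ τ := by
  intro k x
  change (Fintype.card G₀ : ℂ)⁻¹ • ∑ h : G₀, τ h⁻¹ (f (h * (k * x))) =
    τ k ((Fintype.card G₀ : ℂ)⁻¹ • ∑ h : G₀, τ h⁻¹ (f (h * x)))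
  rw [map_smul, map_sum]
  congr 1
  refine Fintype.sum_equiv (Equiv.mulRight k) _ _ fun h => ?_
  rw [← Module.End.mul_apply, ← map_mul]
  simp [mul_assoc]

theorem indProj_apply_of_mem [Fintype G₀] {V : Type*}
    [AddCommGroup V] [Module ℂ V] (τ : Representation ℂ G₀ V) {f : G → V}
    (hf : f ∈ indCarrier G₀ τ) : indProj G₀ τ f = f := by
  funext x
  change (Fintype.card G₀ : ℂ)⁻¹ • ∑ h : G₀, τ h⁻¹ (f (h * x)) = f x
  have : ∀ h : G₀, τ h⁻¹ (f (h * x)) = f x := fun h => by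
    rw [hf h x, ← Module.End.mul_apply, ← map_mul]
    simp
  simp only [this, Finset.sum_const, Finset.card_univ, ← Nat.cast_smul_eq_nsmul ℂ]
  rw [smul_smul, inv_mul_cancel₀ (by simp), one_smul]

open Classical in
/-- The Frobenius formula for the character of an induced representation. -/
theorem indChar_eq_sum [Fintype G] {V : Type*}
    [AddCommGroup V] [Module ℂ V] [FiniteDimensional ℂ V] (τ : Representation ℂ G₀ V) (g : G) :
    indChar G₀ τ g = (Fintype.card G₀ : ℂ)⁻¹ *
      ∑ x : {x : G // x * g * x⁻¹ ∈ G₀}, LinearMap.trace ℂ V (τ ⟨x.1 * g * x.1⁻¹, x.2⟩) := by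
  let R : (G → V) →ₗ[ℂ] (G → V) := LinearMap.funLeft ℂ V (· * g)
  have htr : indChar G₀ τ g = LinearMap.trace ℂ (G → V) (R ∘ₗ indProj G₀ τ) := by
    have e : indRep G₀ τ g = ((indProj G₀ τ).codRestrict _ (indProj_mem G₀ τ)) ∘ₗ
        (R ∘ₗ (indCarrier G₀ τ).subtype) := by
      ext1 f
      apply Subtype.ext
      exact (indProj_apply_of_mem G₀ τ (indRep G₀ τ g f).2).symm
    rw [indChar, e, LinearMap.trace_comp_comm', LinearMap.comp_assoc,
      LinearMap.subtype_comp_codRestrict]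
  rw [htr, trace_pi_eq_sum_trace_diag, Finset.mul_sum]
  have hdiag : ∀ x : G, LinearMap.proj x ∘ₗ (R ∘ₗ indProj G₀ τ) ∘ₗ
      LinearMap.single ℂ (fun _ => V) x =
        if hx : x * g * x⁻¹ ∈ G₀ then (Fintype.card G₀ : ℂ)⁻¹ • τ ⟨x * g * x⁻¹, hx⟩ else 0 := by
    intro x
    ext1 v
    change (Fintype.card G₀ : ℂ)⁻¹ • ∑ h : G₀, τ h⁻¹ ((Pi.single x v : G → V) (h * (x * g))) = _
    have hiff : ∀ h : G₀, (h : G) * (x * g) = x ↔ x * g * x⁻¹ = ((h⁻¹ : G₀) : G) := fun h => by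
      rw [Subgroup.coe_inv, mul_inv_eq_iff_eq_mul, eq_inv_mul_iff_mul_eq]
    split_ifs with hx
    · rw [Finset.sum_eq_single (⟨x * g * x⁻¹, hx⟩⁻¹ : G₀)]
      · rw [(hiff _).2 (by simp), Pi.single_eq_same, inv_inv, LinearMap.smul_apply]
      · intro h _ hne
        rw [Pi.single_eq_of_ne, map_zero]
        intro heq
        exact hne (inv_eq_iff_eq_inv.1 (Subtype.ext ((hiff h).1 heq)).symm)
      · simp
    · rw [Finset.sum_eq_zero, smul_zero, LinearMap.zero_apply]
      intro h _
      rw [Pi.single_eq_of_ne, map_zero]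
      intro heq
      exact hx ((hiff h).1 heq ▸ (h⁻¹).2)
  refine (Fintype.sum_of_injective Subtype.val Subtype.val_injective _ _ (fun x hx => ?_)
    fun x => ?_).symm
  · rw [hdiag, dif_neg (by simpa using hx), map_zero]
  · rw [hdiag, dif_pos x.2, map_smul, smul_eq_mul]

/-- Characters are additive along complementary subrepresentations. -/
theorem character_eq_add_of_isCompl {H : Type} [Group H] {V : Type} [AddCommGroup V] [Module ℂ V]
    [FiniteDimensional ℂ V] {ρ : Representation ℂ H V} {σ σ' : Subrepresentation ρ}
    (h : IsCompl σ σ') :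
    ρ.character = σ.toRepresentation.character + σ'.toRepresentation.character := by
  have hc : IsCompl σ.toSubmodule σ'.toSubmodule := by
    refine IsCompl.of_eq ?_ ?_
    · rw [← Subrepresentation.toSubmodule_inf, h.inf_eq_bot]; rfl
    · rw [← Subrepresentation.toSubmodule_sup, h.sup_eq_top]; rfl
  funext g
  have e : ρ g = (Submodule.prodEquivOfIsCompl _ _ hc).conj
      ((σ.toRepresentation g).prodMap (σ'.toRepresentation g)) := by
    ext v
    obtain ⟨w, rfl⟩ := (Submodule.prodEquivOfIsCompl _ _ hc).surjective v
    simp [LinearEquiv.conj_apply, Subrepresentation.toRepresentation]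
  simp only [Representation.character, Pi.add_apply]
  rw [e, LinearMap.trace_conj', LinearMap.trace_prodMap']

open CategoryTheory in
theorem simple_of_isIrreducible {H : Type} [Group H] [Finite H] {V : Type} [AddCommGroup V]
    [Module ℂ V] [FiniteDimensional ℂ V] (ρ : Representation ℂ H V) [ρ.IsIrreducible] :
    Simple (FDRep.of ρ) := by
  have := Fintype.ofFinite H
  rw [FDRep.simple_iff_char_is_norm_one]
  have hc : (Nat.card H : ℂ) ≠ 0 := by simp
  have := invertibleOfNonzero hc
  have horth := Representation.char_orthonormal ρ ρ
  rw [if_pos ⟨.refl ρ⟩, inv_mul_eq_one₀ hc] at horth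
  exact horth.symm

open CategoryTheory in
/-- Every character of a finite group is a linear combination of irreducible characters. -/
theorem character_mem_span_simple {H : Type} [Group H] [Finite H] {V : Type} [AddCommGroup V]
    [Module ℂ V] [FiniteDimensional ℂ V] (ρ : Representation ℂ H V) :
    ρ.character ∈ Submodule.span ℂ {f : H → ℂ | ∃ τ : FDRep ℂ H, Simple τ ∧ f = τ.character} := by
  induction hn : Module.finrank ℂ V using Nat.strong_induction_on generalizing V with
  | _ n ih =>
  by_cases hirr : ρ.IsIrreducible
  · exact Submodule.subset_span ⟨FDRep.of ρ, simple_of_isIrreducible ρ, rfl⟩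
  by_cases hV : Nontrivial V
  · have : ∃ σ : Subrepresentation ρ, σ ≠ ⊥ ∧ σ ≠ ⊤ := by
      by_contra! hσ
      have : Nontrivial (Subrepresentation ρ) :=
        ⟨⊥, ⊤, fun h => bot_ne_top (congrArg Subrepresentation.toSubmodule h)⟩
      exact hirr ⟨fun σ => or_iff_not_imp_left.2 (hσ σ)⟩
    obtain ⟨σ, hb, ht⟩ := this
    obtain ⟨σ', hc⟩ := exists_isCompl σ
    have lt : ∀ σ : Subrepresentation ρ, σ ≠ ⊤ → Module.finrank ℂ σ.toSubmodule < n := by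
      intro σ h
      rw [← hn]
      exact Submodule.finrank_lt fun h' => h (Subrepresentation.toSubmodule_injective h')
    rw [character_eq_add_of_isCompl hc]
    refine Submodule.add_mem _ (ih _ (lt σ ht) _ rfl) (ih _ (lt σ' ?_) _ rfl)
    rintro rfl
    exact hb (by simpa using hc.inf_eq_bot)
  · rw [not_nontrivial_iff_subsingleton] at hV
    have : ρ.character = 0 := by
      funext g
      simp [Representation.character, Subsingleton.elim (ρ g) 0]
    rw [this]
    exact Submodule.zero_mem _

theorem exists_character_eq_pow {H : Type} [Group H] (τ : FDRep ℂ H) (n : ℕ) :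
    ∃ σ : FDRep ℂ H, σ.character = τ.character ^ n := by
  induction n with
  | zero =>
    refine ⟨FDRep.of (Representation.trivial ℂ (G := H) (V := ℂ)), ?_⟩
    funext g
    simp [FDRep.character]
  | succ n ih =>
    obtain ⟨σ, hσ⟩ := ih
    open CategoryTheory MonoidalCategory in
    exact ⟨σ ⊗ τ, by rw [FDRep.char_tensor, hσ, pow_succ]⟩

/-- A finite family is constantly `c` if `c` is one of its values and averaging every power of the
family gives the same power of `c`. -/
theorem eq_of_forall_sum_pow_eq {ι : Type*} [Fintype ι] (a : ι → ℂ) (j : ι)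
    (h : ∀ n : ℕ, ∑ i, a i ^ n = Fintype.card ι * a j ^ n) (i : ι) : a i = a j := by
  classical
  by_contra hne
  have hp (p : Polynomial ℂ) : ∑ i, p.eval (a i) = Fintype.card ι * p.eval (a j) := by
    induction p using Polynomial.induction_on' with
    | add p q hp hq => simp [Finset.sum_add_distrib, hp, hq, mul_add]
    | monomial n c => simp only [Polynomial.eval_monomial, ← Finset.mul_sum, h]; ring
  let p : Polynomial ℂ := ∏ v ∈ (Finset.univ.image a).erase (a i), (.X - .C v)
  have hz : ∀ k, a k ≠ a i → p.eval (a k) = 0 := fun k hk => by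
    rw [Polynomial.eval_prod]
    exact Finset.prod_eq_zero (i := a k) (by simp [hk]) (by simp)
  have hnz : p.eval (a i) ≠ 0 := by
    rw [Polynomial.eval_prod, Finset.prod_ne_zero_iff]
    intro v hv
    simpa [sub_eq_zero] using (Finset.ne_of_mem_erase hv).symm
  have key := hp p
  have hk : ∀ k, p.eval (a k) = if a k = a i then p.eval (a i) else 0 := fun k => by
    split_ifs with hk
    · rw [hk]
    · exact hz k hk
  rw [hz j (Ne.symm hne), mul_zero, Finset.sum_congr rfl fun k _ => hk k, ← Finset.sum_filter,
    Finset.sum_const, nsmul_eq_mul, mul_eq_zero, or_iff_left hnz, Nat.cast_eq_zero,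
    Finset.card_eq_zero] at key
  exact Finset.notMem_empty i (key ▸ by simp)

open CategoryTheory in
/-- If for every irreducible finite-dimensional complex representation `τ` of `G₀` and every
`g ∈ G₀` one has `χ_{Ind_{G₀}^G τ}(g) = χ_{Ind_{G₀}^G 1}(g) · χ_τ(g)` (where `1` is the trivial
one-dimensional representation of `G₀`), then `(G, G₀)` is an admissible pair. -/
theorem isAdmissiblePair_of_char_ind [Fintype G]
    (h : ∀ (τ : FDRep ℂ G₀), Simple τ → ∀ (g : G) (hg : g ∈ G₀),
      indChar G₀ τ.ρ g =
        indChar G₀ (Representation.trivial ℂ (G := G₀) (V := ℂ)) g * τ.character ⟨g, hg⟩) :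
    IsAdmissiblePair G G₀ := by
  intro τ _ g s hg hs
  classical
  let X := {x : G // x * g * x⁻¹ ∈ G₀}
  let c : X → G₀ := fun x => ⟨x.1 * g * x.1⁻¹, x.2⟩
  have hcard : (Fintype.card G₀ : ℂ)⁻¹ ≠ 0 := by simp
  have havg : ∀ f ∈ Submodule.span ℂ {f : G₀ → ℂ | ∃ τ : FDRep ℂ G₀, Simple τ ∧ f = τ.character},
      ∑ x : X, f (c x) = Fintype.card X * f ⟨g, hg⟩ := by
    intro f hf
    induction hf using Submodule.span_induction with
    | mem f hf =>
      obtain ⟨σ, hσ, rfl⟩ := hf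
      have := h σ hσ g hg
      rw [indChar_eq_sum, indChar_eq_sum, mul_assoc, mul_right_inj' hcard] at this
      simpa [FDRep.character, X, c] using this
    | zero => simp
    | add f₁ f₂ _ _ h₁ h₂ => simp [Finset.sum_add_distrib, h₁, h₂, mul_add]
    | smul a f _ hf => simp only [Pi.smul_apply, smul_eq_mul, ← Finset.mul_sum, hf]; ring
  have h1 : c ⟨1, by simpa using hg⟩ = ⟨g, hg⟩ := by simp [c]
  have := eq_of_forall_sum_pow_eq (fun x : X => τ.character (c x)) ⟨1, by simpa using hg⟩
    (fun n => by
      obtain ⟨σ, hσ⟩ := exists_character_eq_pow τ n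
      have := havg σ.character (character_mem_span_simple σ.ρ)
      simpa [hσ, h1] using this) ⟨s, hs⟩
  simpa [h1] using this
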